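/- arXiv:1605.02078 — 2 statements merged into one kernel-verified Lean document; each statement's English description precedes it below -/
import Mathlib

section
/- Consider the causal structure with observed variables X, Y, Z and hidden variables A, B, in which compatible joint distributions factorize as P_{XYZAB} = P_A · P_B · P_{X|AB} · P_{Y|AX} · P_{Z|BX}. For each of the eleven vectors v ∈ {(1,1,2,2,2,2,2), (1,2,1,2,2,2,2), (1,1,1,2,2,2,2), (1,2,2,2,2,2,2), (1,1,1,2,2,1,2), (1,1,1,1,1,1,1), (1,0,1,1,1,1,1), (1,1,0,1,1,1,1), (1,0,0,1,1,0,1), (0,1,0,1,0,1,1), (0,0,1,0,1,1,1)} (coordinates ordered as (H(X), H(Y), H(Z), H(XY), H(XZ), H(YZ), H(XYZ))) there exist random variables X, Y, Z, A, B with the stated factorization such that the entropy vector of (X, Y, Z) equals (log 2) · v. -/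
open Finset
open scoped Classical

/-- Probability that the random variable `X` (on the finite weighted sample space
`(Ω, μ)`) takes the value `b`. -/
noncomputable def pr {Ω β : Type*} [Fintype Ω] (μ : Ω → ℝ) (X : Ω → β) (b : β) : ℝ :=
  ∑ ω, if X ω = b then μ ω else 0

/-- Shannon entropy of the random variable `X` on the finite weighted sample space
`(Ω, μ)`. -/
noncomputable def ent {Ω β : Type*} [Fintype Ω] [Fintype β] (μ : Ω → ℝ) (X : Ω → β) : ℝ :=
  ∑ b, Real.negMulLog (pr μ X b)

/-- Mutual information `I(X : Y)`. -/
noncomputable def mi {Ω β γ : Type*} [Fintype Ω] [Fintype β] [Fintype γ]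
    (μ : Ω → ℝ) (X : Ω → β) (Y : Ω → γ) : ℝ :=
  ent μ X + ent μ Y - ent μ (fun ω => (X ω, Y ω))

/-- Conditional mutual information `I(X : Y | Z)`. -/
noncomputable def cmi {Ω β γ δ : Type*} [Fintype Ω] [Fintype β] [Fintype γ] [Fintype δ]
    (μ : Ω → ℝ) (X : Ω → β) (Y : Ω → γ) (Z : Ω → δ) : ℝ :=
  ent μ (fun ω => (X ω, Z ω)) + ent μ (fun ω => (Y ω, Z ω)) - ent μ Z
    - ent μ (fun ω => (X ω, Y ω, Z ω))

/-- The Ingleton quantity `I_ING(S,T;U,V)`. -/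
noncomputable def ing {Ω β γ δ ε : Type*} [Fintype Ω] [Fintype β] [Fintype γ] [Fintype δ]
    [Fintype ε] (μ : Ω → ℝ) (S : Ω → β) (T : Ω → γ) (U : Ω → δ) (V : Ω → ε) : ℝ :=
  cmi μ S T U + cmi μ S T V + mi μ U V - mi μ S T

/-- A (finite, classical) model of the causal structure with observed variables
`X, Y, Z` and hidden independent variables `A, B`, where `X` is a child of `A` and `B`,
`Y` a child of `A` and `X`, and `Z` a child of `B` and `X`; compatible joint
distributions factorise as `P_{XYZAB} = P_A · P_B · P_{X|AB} · P_{Y|AX} · P_{Z|BX}`. -/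
structure HensonCModel where
  Ω : Type
  [instΩ : Fintype Ω]
  SX : Type
  [instSX : Fintype SX]
  SY : Type
  [instSY : Fintype SY]
  SZ : Type
  [instSZ : Fintype SZ]
  SA : Type
  [instSA : Fintype SA]
  SB : Type
  [instSB : Fintype SB]
  μ : Ω → ℝ
  X : Ω → SX
  Y : Ω → SY
  Z : Ω → SZ
  A : Ω → SA
  B : Ω → SB
  pA : SA → ℝ
  pB : SB → ℝ
  qX : SX → SA → SB → ℝ
  qY : SY → SA → SX → ℝ
  qZ : SZ → SB → SX → ℝ
  hμ0 : ∀ ω, 0 ≤ μ ω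
  hμ1 : ∑ ω, μ ω = 1
  hpA0 : ∀ a, 0 ≤ pA a
  hpA1 : ∑ a, pA a = 1
  hpB0 : ∀ b, 0 ≤ pB b
  hpB1 : ∑ b, pB b = 1
  hqX0 : ∀ x a b, 0 ≤ qX x a b
  hqX1 : ∀ a b, ∑ x, qX x a b = 1
  hqY0 : ∀ y a x, 0 ≤ qY y a x
  hqY1 : ∀ a x, ∑ y, qY y a x = 1
  hqZ0 : ∀ z b x, 0 ≤ qZ z b x
  hqZ1 : ∀ b x, ∑ z, qZ z b x = 1
  hfact : ∀ x y z a b,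
    pr μ (fun ω => (X ω, Y ω, Z ω, A ω, B ω)) (x, y, z, a, b)
      = pA a * pB b * qX x a b * qY y a x * qZ z b x

attribute [instance] HensonCModel.instΩ HensonCModel.instSX HensonCModel.instSY
  HensonCModel.instSZ HensonCModel.instSA HensonCModel.instSB

/-- The entropy vector `(H(X), H(Y), H(Z), H(XY), H(XZ), H(YZ), H(XYZ))` of the observed
variables of the model. -/
noncomputable def HensonCModel.entVec (M : HensonCModel) : Fin 7 → ℝ :=
  ![ent M.μ M.X, ent M.μ M.Y, ent M.μ M.Z,
    ent M.μ (fun ω => (M.X ω, M.Y ω)),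
    ent M.μ (fun ω => (M.X ω, M.Z ω)),
    ent M.μ (fun ω => (M.Y ω, M.Z ω)),
    ent M.μ (fun ω => (M.X ω, M.Y ω, M.Z ω))]

/-- Entropy as an expectation over the sample space. -/
lemma ent_eq_sum {Ω β : Type*} [Fintype Ω] [Fintype β] (μ : Ω → ℝ) (X : Ω → β) :
    ent μ X = ∑ ω, μ ω * -Real.log (pr μ X (X ω)) := by
  have h : ∀ b, Real.negMulLog (pr μ X b)
      = ∑ ω, if X ω = b then μ ω * -Real.log (pr μ X b) else 0 := by
    intro b
    rw [Real.negMulLog, neg_mul_comm]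
    conv_lhs => rw [pr, Finset.sum_mul]
    simp only [ite_mul, zero_mul, pr]
  simp only [ent, h]
  rw [Finset.sum_comm]
  simp

/-- The uniform distribution on pairs of bits. -/
noncomputable def twoBits : Bool × Bool → ℝ := fun _ => 1 / 4

/-- All nonempty fibres of `F` have `2 ^ (2 - k)` elements, so that `F` takes `2 ^ k` values
equally often. -/
def TwoBitBalanced {β : Type} [DecidableEq β] (F : Bool × Bool → β) (k : ℕ) : Prop :=
  ∀ ω, #{ω' | F ω' = F ω} * 2 ^ k = 4

instance {β : Type} [DecidableEq β] (F : Bool × Bool → β) (k : ℕ) :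
    Decidable (TwoBitBalanced F k) :=
  inferInstanceAs (Decidable (∀ ω, #{ω' | F ω' = F ω} * 2 ^ k = 4))

lemma TwoBitBalanced.ent_eq {β : Type} [Fintype β] [DecidableEq β] {F : Bool × Bool → β} {k : ℕ}
    (h : TwoBitBalanced F k) : ent twoBits F = Real.log 2 * k := by
  have hpr : ∀ ω, pr twoBits F (F ω) = ((2 : ℝ) ^ k)⁻¹ := by
    intro ω
    have h1 : pr twoBits F (F ω) = (#{ω' | F ω' = F ω} : ℝ) * (1 / 4) := by
      rw [← nsmul_eq_mul, ← Finset.sum_const, Finset.sum_filter, pr]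
      exact Finset.sum_congr rfl fun _ _ => by congr!
    have h2 : (#{ω' | F ω' = F ω} : ℝ) * 2 ^ k = 4 := by exact_mod_cast h ω
    apply eq_inv_of_mul_eq_one_left
    rw [h1]
    linarith
  rw [ent_eq_sum]
  simp only [hpr, twoBits, Real.log_inv, Real.log_pow, neg_neg, Finset.sum_const,
    Finset.card_univ, Fintype.card_prod, Fintype.card_bool, nsmul_eq_mul]
  push_cast
  ring

/-- The model in which the hidden variables are independent uniform bits and the observed
variables are deterministic functions of their parents. -/
noncomputable def HensonCModel.ofFun {SX SY SZ : Type} [Fintype SX] [Fintype SY] [Fintype SZ]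
    (f : Bool → Bool → SX) (g : Bool → SX → SY) (h : Bool → SX → SZ) : HensonCModel where
  Ω := Bool × Bool
  SX := SX
  SY := SY
  SZ := SZ
  SA := Bool
  SB := Bool
  μ := twoBits
  X := fun ω => f ω.1 ω.2
  Y := fun ω => g ω.1 (f ω.1 ω.2)
  Z := fun ω => h ω.2 (f ω.1 ω.2)
  A := Prod.fst
  B := Prod.snd
  pA := fun _ => 1 / 2
  pB := fun _ => 1 / 2
  qX := fun x a b => if x = f a b then 1 else 0
  qY := fun y a x => if y = g a x then 1 else 0
  qZ := fun z b x => if z = h b x then 1 else 0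
  hμ0 := fun _ => by norm_num [twoBits]
  hμ1 := by norm_num [twoBits]
  hpA0 := fun _ => by norm_num
  hpA1 := by norm_num
  hpB0 := fun _ => by norm_num
  hpB1 := by norm_num
  hqX0 := fun _ _ _ => by split_ifs <;> norm_num
  hqX1 := fun _ _ => by simp
  hqY0 := fun _ _ _ => by split_ifs <;> norm_num
  hqY1 := fun _ _ => by simp
  hqZ0 := fun _ _ _ => by split_ifs <;> norm_num
  hqZ1 := fun _ _ => by simp
  hfact := by
    intro x y z a b
    have hite : ∀ ω : Bool × Bool,
        (if (f ω.1 ω.2, g ω.1 (f ω.1 ω.2), h ω.2 (f ω.1 ω.2), ω.1, ω.2) = (x, y, z, a, b)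
          then twoBits ω else 0)
        = if ω = (a, b) then
            (if x = f a b ∧ y = g a x ∧ z = h b x then 1 / 4 else 0) else 0 := by
      rintro ⟨a', b'⟩
      by_cases hab : (a', b') = (a, b)
      · obtain ⟨rfl, rfl⟩ := Prod.mk.inj hab
        by_cases hx : x = f a' b'
        · subst hx
          simp [twoBits, eq_comm]
        · simp [hx, Ne.symm hx]
      · simp only [Prod.mk.injEq] at hab ⊢
        rw [if_neg hab, if_neg (by tauto)]
    have hpr : pr twoBits
          (fun ω => (f ω.1 ω.2, g ω.1 (f ω.1 ω.2), h ω.2 (f ω.1 ω.2), ω.1, ω.2)) (x, y, z, a, b)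
        = ∑ ω : Bool × Bool, if ω = (a, b) then
            (if x = f a b ∧ y = g a x ∧ z = h b x then (1 / 4 : ℝ) else 0) else 0 :=
      Finset.sum_congr rfl fun ω _ => by convert hite ω
    rw [hpr, Finset.sum_ite_eq']
    simp only [Finset.mem_univ, if_true]
    split_ifs <;> first | tauto | norm_num

/-- A deterministic model realises the vector `v` whenever all the joint observed variables are
balanced with the corresponding numbers of bits. -/
lemma HensonCModel.entVec_ofFun {SX SY SZ : Type} [Fintype SX] [Fintype SY] [Fintype SZ]
    [DecidableEq SX] [DecidableEq SY] [DecidableEq SZ]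
    (f : Bool → Bool → SX) (g : Bool → SX → SY) (h : Bool → SX → SZ)
    {x y z xy xz yz xyz : ℕ}
    (hb : TwoBitBalanced (fun ω => f ω.1 ω.2) x ∧
      TwoBitBalanced (fun ω => g ω.1 (f ω.1 ω.2)) y ∧
      TwoBitBalanced (fun ω => h ω.2 (f ω.1 ω.2)) z ∧
      TwoBitBalanced (fun ω => (f ω.1 ω.2, g ω.1 (f ω.1 ω.2))) xy ∧
      TwoBitBalanced (fun ω => (f ω.1 ω.2, h ω.2 (f ω.1 ω.2))) xz ∧
      TwoBitBalanced (fun ω => (g ω.1 (f ω.1 ω.2), h ω.2 (f ω.1 ω.2))) yz ∧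
      TwoBitBalanced (fun ω => (f ω.1 ω.2, g ω.1 (f ω.1 ω.2), h ω.2 (f ω.1 ω.2))) xyz)
    {v : Fin 7 → ℝ} (hv : v = ![(x : ℝ), y, z, xy, xz, yz, xyz]) :
    ∃ M : HensonCModel, M.entVec = fun i => Real.log 2 * v i := by
  obtain ⟨hX, hY, hZ, hXY, hXZ, hYZ, hXYZ⟩ := hb
  subst hv
  refine ⟨ofFun f g h, funext fun i => ?_⟩
  fin_cases i
  · exact hX.ent_eq
  · exact hY.ent_eq
  · exact hZ.ent_eq
  · exact hXY.ent_eq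
  · exact hXZ.ent_eq
  · exact hYZ.ent_eq
  · exact hXYZ.ent_eq

/-- **Achievability of the eleven extremal rays.** Each of the eleven listed vectors is,
after scaling by `log 2`, the entropy vector of the observed variables of some
distribution compatible with the causal structure of Figure 6(c). -/
theorem henson_c_rays_achievable :
    ∀ v ∈ ([![1, 1, 2, 2, 2, 2, 2],
            ![1, 2, 1, 2, 2, 2, 2],
            ![1, 1, 1, 2, 2, 2, 2],
            ![1, 2, 2, 2, 2, 2, 2],
            ![1, 1, 1, 2, 2, 1, 2],
            ![1, 1, 1, 1, 1, 1, 1],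
            ![1, 0, 1, 1, 1, 1, 1],
            ![1, 1, 0, 1, 1, 1, 1],
            ![1, 0, 0, 1, 1, 0, 1],
            ![0, 1, 0, 1, 0, 1, 1],
            ![0, 0, 1, 0, 1, 1, 1]] : List (Fin 7 → ℝ)),
      ∃ M : HensonCModel, M.entVec = fun i => Real.log 2 * v i := by
  simp only [List.forall_mem_cons, List.not_mem_nil, false_implies, implies_true, and_true]
  refine ⟨?_, ?_, ?_, ?_, ?_, ?_, ?_, ?_, ?_, ?_, ?_⟩
  · exact HensonCModel.entVec_ofFun (x := 1) (y := 1) (z := 2) (xy := 2) (xz := 2) (yz := 2)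
      (xyz := 2) xor (fun a _ => a) (fun b x => (b, x)) (by decide) (by norm_num)
  · exact HensonCModel.entVec_ofFun (x := 1) (y := 2) (z := 1) (xy := 2) (xz := 2) (yz := 2)
      (xyz := 2) xor (fun a x => (a, x)) (fun b _ => b) (by decide) (by norm_num)
  · exact HensonCModel.entVec_ofFun (x := 1) (y := 1) (z := 1) (xy := 2) (xz := 2) (yz := 2)
      (xyz := 2) xor (fun a _ => a) (fun b _ => b) (by decide) (by norm_num)
  · exact HensonCModel.entVec_ofFun (x := 1) (y := 2) (z := 2) (xy := 2) (xz := 2) (yz := 2)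
      (xyz := 2) xor (fun a x => (a, x)) (fun b x => (b, x)) (by decide) (by norm_num)
  · exact HensonCModel.entVec_ofFun (x := 1) (y := 1) (z := 1) (xy := 2) (xz := 2) (yz := 1)
      (xyz := 2) xor (fun a _ => a) xor (by decide) (by norm_num)
  · exact HensonCModel.entVec_ofFun (x := 1) (y := 1) (z := 1) (xy := 1) (xz := 1) (yz := 1)
      (xyz := 1) (fun a _ => a) (fun _ x => x) (fun _ x => x) (by decide) (by norm_num)
  · exact HensonCModel.entVec_ofFun (x := 1) (y := 0) (z := 1) (xy := 1) (xz := 1) (yz := 1)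
      (xyz := 1) (fun a _ => a) (fun _ _ => ()) (fun _ x => x) (by decide) (by norm_num)
  · exact HensonCModel.entVec_ofFun (x := 1) (y := 1) (z := 0) (xy := 1) (xz := 1) (yz := 1)
      (xyz := 1) (fun a _ => a) (fun _ x => x) (fun _ _ => ()) (by decide) (by norm_num)
  · exact HensonCModel.entVec_ofFun (x := 1) (y := 0) (z := 0) (xy := 1) (xz := 1) (yz := 0)
      (xyz := 1) (fun a _ => a) (fun _ _ => ()) (fun _ _ => ()) (by decide) (by norm_num)
  · exact HensonCModel.entVec_ofFun (x := 0) (y := 1) (z := 0) (xy := 1) (xz := 0) (yz := 1)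
      (xyz := 1) (fun _ _ => ()) (fun a _ => a) (fun _ _ => ()) (by decide) (by norm_num)
  · exact HensonCModel.entVec_ofFun (x := 0) (y := 0) (z := 1) (xy := 0) (xz := 1) (yz := 1)
      (xyz := 1) (fun _ _ => ()) (fun _ _ => ()) (fun b _ => b) (by decide) (by norm_num)
end

section
/- Let 𝒜, ℬ, 𝒞 be finite types with probability mass functions p_A, p_B, p_C, and let κ_X : ℬ × 𝒞 → PMF({−1,1} × {0,1}), κ_Y : 𝒜 × 𝒞 → PMF({−1,1} × {0,1}), κ_Z : 𝒜 × ℬ → PMF({0,1}) be conditional distributions; write (X̃, B̃) for the output of κ_X, (Ỹ, Ã) for the output of κ_Y, and Z for the output of κ_Z, with induced joint distribution P(x̃, b̃, ỹ, ã, z) = Σ_{a,b,c} p_A(a) p_B(b) p_C(c) κ_X(b,c)(x̃,b̃) κ_Y(a,c)(ỹ,ã) κ_Z(a,b)(z). Suppose P is supported on z = AND(ã, b̃), that P(Z=1) > 0, and that P(Ã=ã, B̃=b̃) > 0 for all ã, b̃ ∈ {0,1}. Define the correlators E(ã, b̃) := E[X̃ · Ỹ | Ã=ã, B̃=b̃].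 Then the CHSH expression satisfies E(0,0) + E(0,1) + E(1,0) − E(1,1) ≤ 2. -/
open scoped ENNReal

/-- The CHSH inequality for four numbers in `[-1, 1]`. -/
lemma chsh_pointwise {x x' y y' : ℝ} (hx : |x| ≤ 1) (hx' : |x'| ≤ 1)
    (hy : |y| ≤ 1) (hy' : |y'| ≤ 1) : y * x + y * x' + y' * x - y' * x' ≤ 2 := by
  have h₁ : y * (x + x') ≤ |x + x'| := by
    calc y * (x + x') ≤ |y| * |x + x'| := (le_abs_self _).trans (abs_mul _ _).le
      _ ≤ |x + x'| := mul_le_of_le_one_left (abs_nonneg _) hy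
  have h₂ : y' * (x - x') ≤ |x - x'| := by
    calc y' * (x - x') ≤ |y'| * |x - x'| := (le_abs_self _).trans (abs_mul _ _).le
      _ ≤ |x - x'| := mul_le_of_le_one_left (abs_nonneg _) hy'
  have h₃ : |x + x'| + |x - x'| ≤ 2 := by
    rw [abs_le] at hx hx'
    rcases abs_cases (x + x') with h | h <;> rcases abs_cases (x - x') with h' | h' <;> linarith
  linarith

/-- The CHSH inequality for a local hidden variable model with hidden variable `c`. -/
lemma chsh_local_model {C : Type*} [Fintype C] {w : C → ℝ} (hw : ∀ c, 0 ≤ w c)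
    (hw_sum : ∑ c, w c = 1) {u v : Bool → C → ℝ}
    (hu : ∀ t c, w c ≠ 0 → |u t c| ≤ 1) (hv : ∀ t c, w c ≠ 0 → |v t c| ≤ 1) :
    ∑ c, w c * (u false c * v false c) + ∑ c, w c * (u false c * v true c)
      + ∑ c, w c * (u true c * v false c) - ∑ c, w c * (u true c * v true c) ≤ 2 := by
  rw [← Finset.sum_add_distrib, ← Finset.sum_add_distrib, ← Finset.sum_sub_distrib]
  calc _ ≤ ∑ c, w c * 2 := Finset.sum_le_sum fun c _ => ?_
    _ = 2 := by rw [← Finset.sum_mul, hw_sum, one_mul]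
  by_cases hc : w c = 0
  · simp [hc]
  · have h := chsh_pointwise (hv false c hc) (hv true c hc) (hu false c hc) (hu true c hc)
    nlinarith [mul_le_mul_of_nonneg_left h (hw c)]

lemma PMF.sum_toReal_eq_one {α : Type*} [Fintype α] (p : PMF α) : ∑ a, (p a).toReal = 1 := by
  rw [← ENNReal.toReal_sum fun a _ => p.apply_ne_top a, ← tsum_fintype (L := .unconditional α),
    p.tsum_coe, ENNReal.toReal_one]

/-- If the second component is almost surely `t₀`, its marginal is the point mass at `t₀`. -/
lemma PMF.sum_fst_toReal_of_snd_eq {S T : Type*} [Fintype S] [Fintype T] [DecidableEq T]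
    (p : PMF (S × T)) {t₀ : T} (h : ∀ s t, p (s, t) ≠ 0 → t = t₀) (t : T) :
    ∑ s, (p (s, t)).toReal = if t = t₀ then 1 else 0 := by
  have hzero : ∀ t, t ≠ t₀ → ∑ s, (p (s, t)).toReal = 0 := fun t ht =>
    Finset.sum_eq_zero fun s _ => by
      rw [not_ne_iff.mp (mt (h s t) ht), ENNReal.toReal_zero]
  split_ifs with ht
  · subst ht
    rw [← p.sum_toReal_eq_one, Fintype.sum_prod_type_right,
      Fintype.sum_eq_single t hzero]
  · exact hzero t ht

/-- The integral of `f` over the event that the second output of `κ` equals `t`, when the input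
is `(i, c)` with `i` drawn from `p`. -/
noncomputable def outcomeMean {I C S : Type*} [Fintype I] [Fintype S] (p : PMF I)
    (κ : I × C → PMF (S × Bool)) (f : S → ℝ) (t : Bool) (c : C) : ℝ :=
  ∑ i, (p i).toReal * ∑ s, f s * (κ (i, c) (s, t)).toReal

lemma outcomeMean_one_eq {I C S : Type*} [Fintype I] [Fintype S] {p : PMF I}
    {κ : I × C → PMF (S × Bool)} {τ : I → Bool} {c : C}
    (h : ∀ i s t, p i ≠ 0 → κ (i, c) (s, t) ≠ 0 → t = τ i) (t : Bool) :
    outcomeMean p κ (fun _ => 1) t c = ∑ i, (p i).toReal * if t = τ i then 1 else 0 := by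
  refine Finset.sum_congr rfl fun i _ => ?_
  by_cases hi : p i = 0
  · simp [hi]
  · simp only [one_mul]
    rw [PMF.sum_fst_toReal_of_snd_eq _ fun s t => h i s t hi]

lemma abs_outcomeMean_le {I C S : Type*} [Fintype I] [Fintype S] (p : PMF I)
    (κ : I × C → PMF (S × Bool)) {f : S → ℝ} (hf : ∀ s, |f s| ≤ 1) (t : Bool) (c : C) :
    |outcomeMean p κ f t c| ≤ outcomeMean p κ (fun _ => 1) t c := by
  refine (Finset.abs_sum_le_sum_abs _ _).trans (Finset.sum_le_sum fun i _ => ?_)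
  rw [abs_mul, abs_of_nonneg ENNReal.toReal_nonneg]
  refine mul_le_mul_of_nonneg_left ((Finset.abs_sum_le_sum_abs _ _).trans
    (Finset.sum_le_sum fun s _ => ?_)) ENNReal.toReal_nonneg
  rw [abs_mul, abs_of_nonneg (ENNReal.toReal_nonneg (a := κ (i, c) (s, t)))]
  exact mul_le_mul_of_nonneg_right (hf s) ENNReal.toReal_nonneg

/-- Marginalizing the output of `κZ` out of the triangle leaves a Bell scenario. -/
lemma toReal_sum_triangle {A B C S : Type*} [Fintype A] [Fintype B] [Fintype C]
    (pA : PMF A) (pB : PMF B) (pC : PMF C) (κX : B × C → PMF (S × Bool))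
    (κY : A × C → PMF (S × Bool)) (κZ : A × B → PMF Bool) (x y : S) (tb ta : Bool) :
    (∑ z, ∑ a, ∑ b, ∑ c, pA a * pB b * pC c * κX (b, c) (x, tb) * κY (a, c) (y, ta)
      * κZ (a, b) z).toReal
      = ∑ a, ∑ b, ∑ c, (pA a).toReal * (pB b).toReal * (pC c).toReal
        * (κX (b, c) (x, tb)).toReal * (κY (a, c) (y, ta)).toReal := by
  have hZ : ∀ q : PMF Bool, ∑ z, q z = 1 := fun q => by
    rw [← tsum_fintype (L := .unconditional Bool), q.tsum_coe]
  have hfin : ∀ a b c, pA a * pB b * pC c * κX (b, c) (x, tb) * κY (a, c) (y, ta) ≠ ⊤ :=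
    fun a b c => by
      simp only [ne_eq, ENNReal.mul_eq_top, PMF.apply_ne_top, and_false, false_and, or_self,
        not_false_eq_true]
  rw [Finset.sum_comm]
  rw [Finset.sum_congr rfl fun a _ => (Finset.sum_comm.trans <|
    Finset.sum_congr rfl fun b _ => Finset.sum_comm.trans <|
    Finset.sum_congr rfl fun c _ => by rw [← Finset.mul_sum, hZ, mul_one])]
  rw [ENNReal.toReal_sum fun a _ => by simp [ENNReal.sum_eq_top, hfin]]
  refine Finset.sum_congr rfl fun a _ => ?_
  rw [ENNReal.toReal_sum fun b _ => by simp [ENNReal.sum_eq_top, hfin]]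
  refine Finset.sum_congr rfl fun b _ => ?_
  rw [ENNReal.toReal_sum fun c _ => hfin a b c]
  simp only [ENNReal.toReal_mul]

/-- In a Bell scenario, expectations of products factorize conditionally on the shared source. -/
lemma sum_bell_eq {A B C S : Type*} [Fintype A] [Fintype B] [Fintype C] [Fintype S]
    (pA : PMF A) (pB : PMF B) (pC : PMF C) (κX : B × C → PMF (S × Bool))
    (κY : A × C → PMF (S × Bool)) (f g : S → ℝ) (tb ta : Bool) :
    ∑ x, ∑ y, f x * g y * ∑ a, ∑ b, ∑ c, (pA a).toReal * (pB b).toReal * (pC c).toReal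
        * (κX (b, c) (x, tb)).toReal * (κY (a, c) (y, ta)).toReal
      = ∑ c, (pC c).toReal * (outcomeMean pA κY g ta c * outcomeMean pB κX f tb c) := by
  have hY : ∀ c, outcomeMean pA κY g ta c
      = ∑ y, ∑ a, (pA a).toReal * (g y * (κY (a, c) (y, ta)).toReal) := fun c => by
    simp only [outcomeMean, Finset.mul_sum]
    exact Finset.sum_comm
  have hX : ∀ c, outcomeMean pB κX f tb c
      = ∑ x, ∑ b, (pB b).toReal * (f x * (κX (b, c) (x, tb)).toReal) := fun c => by
    simp only [outcomeMean, Finset.mul_sum]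
    exact Finset.sum_comm
  have hswap : ∀ F : A → B → C → ℝ, ∑ a, ∑ b, ∑ c, F a b c = ∑ c, ∑ a, ∑ b, F a b c :=
    fun F => by
      rw [Finset.sum_congr rfl fun a _ => Finset.sum_comm, Finset.sum_comm]
  have hterm : ∀ x y, f x * g y * ∑ a, ∑ b, ∑ c, (pA a).toReal * (pB b).toReal * (pC c).toReal
        * (κX (b, c) (x, tb)).toReal * (κY (a, c) (y, ta)).toReal
      = ∑ c, (pC c).toReal * ((∑ a, (pA a).toReal * (g y * (κY (a, c) (y, ta)).toReal))
        * ∑ b, (pB b).toReal * (f x * (κX (b, c) (x, tb)).toReal)) := fun x y => by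
    simp only [hswap, Finset.sum_mul_sum]
    simp only [Finset.mul_sum]
    refine Finset.sum_congr rfl fun c _ => Finset.sum_congr rfl fun a _ =>
      Finset.sum_congr rfl fun b _ => ?_
    ring
  simp only [hterm, hX, hY, Finset.sum_mul_sum (Finset.univ : Finset S)]
  simp only [Finset.mul_sum (Finset.univ : Finset S)]
  rw [Finset.sum_comm, Finset.sum_congr rfl fun y _ => Finset.sum_comm, Finset.sum_comm]

/-- If `Z` is the conjunction of the bits produced by `κY` and `κX`, and can equal `1`, then the
bits are functions of the unshared sources `a` and `b`. -/
lemma exists_bit_functions {A B C S : Type*} {pA : PMF A} {pB : PMF B} {pC : PMF C}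
    {κX : B × C → PMF (S × Bool)} {κY : A × C → PMF (S × Bool)} {κZ : A × B → PMF Bool}
    (hand : ∀ a b c x tb y ta z, pA a ≠ 0 → pB b ≠ 0 → pC c ≠ 0 → κX (b, c) (x, tb) ≠ 0 →
      κY (a, c) (y, ta) ≠ 0 → κZ (a, b) z ≠ 0 → z = (ta && tb))
    {a₀ : A} {b₀ : B} (ha₀ : pA a₀ ≠ 0) (hb₀ : pB b₀ ≠ 0) (hz₀ : κZ (a₀, b₀) true ≠ 0) :
    (∃ β : B → Bool, ∀ c, pC c ≠ 0 → ∀ b x t, pB b ≠ 0 → κX (b, c) (x, t) ≠ 0 → t = β b) ∧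
    (∃ α : A → Bool, ∀ c, pC c ≠ 0 → ∀ a y t, pA a ≠ 0 → κY (a, c) (y, t) ≠ 0 → t = α a) := by
  have hY₀ : ∀ c y t, pC c ≠ 0 → κY (a₀, c) (y, t) ≠ 0 → t = true := fun c y t hc h => by
    obtain ⟨⟨x, tb⟩, hx⟩ := (κX (b₀, c)).support_nonempty
    have := hand a₀ b₀ c x tb y t true ha₀ hb₀ hc hx h hz₀
    exact (Bool.and_eq_true_iff.mp this.symm).1
  have hX₀ : ∀ c x t, pC c ≠ 0 → κX (b₀, c) (x, t) ≠ 0 → t = true := fun c x t hc h => by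
    obtain ⟨⟨y, ta⟩, hy⟩ := (κY (a₀, c)).support_nonempty
    have := hand a₀ b₀ c x t y ta true ha₀ hb₀ hc h hy hz₀
    exact (Bool.and_eq_true_iff.mp this.symm).2
  refine ⟨⟨fun b => (κZ (a₀, b)).support_nonempty.some, fun c hc b x t hb h => ?_⟩,
    ⟨fun a => (κZ (a, b₀)).support_nonempty.some, fun c hc a y t ha h => ?_⟩⟩
  · obtain ⟨⟨y, ta⟩, hy⟩ := (κY (a₀, c)).support_nonempty
    have hz := hand a₀ b c x t y ta _ ha₀ hb hc h hy (κZ (a₀, b)).support_nonempty.some_mem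
    rw [hY₀ c y ta hc hy, Bool.true_and] at hz
    exact hz.symm
  · obtain ⟨⟨x, tb⟩, hx⟩ := (κX (b₀, c)).support_nonempty
    have hz := hand a b₀ c x tb y t _ ha hb₀ hc hx h (κZ (a, b₀)).support_nonempty.some_mem
    rw [hX₀ c x tb hc hx, Bool.and_true] at hz
    exact hz.symm

/-- **CHSH bound in the classical triangle with `Z = AND(Ã,B̃)` (Proposition 8).**
Let `pA, pB, pC` be probability mass functions on finite types `𝒜, ℬ, 𝒞` and let
`κX, κY, κZ` be conditional distributions generating the observed pairs `(X̃,B̃)` from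
`(B,C)`, `(Ỹ,Ã)` from `(A,C)` and the bit `Z` from `(A,B)`, where `X̃, Ỹ` take values
in `{−1, 1}`.  If the induced joint distribution `P` is supported on `z = AND(ã,b̃)`,
`P(Z=1) > 0` and `P(Ã=ã,B̃=b̃) > 0` for all bits `ã, b̃`, then the correlators
`E(ã,b̃) = E[X̃·Ỹ | Ã=ã, B̃=b̃]` satisfy the CHSH inequality
`E(0,0) + E(0,1) + E(1,0) − E(1,1) ≤ 2`. -/
theorem triangle_and_chsh_bound {𝒜 ℬ 𝒞 : Type*} [Fintype 𝒜] [Fintype ℬ] [Fintype 𝒞]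
    (pA : PMF 𝒜) (pB : PMF ℬ) (pC : PMF 𝒞)
    (κX : ℬ × 𝒞 → PMF ((({-1, 1} : Finset ℤ) : Type) × Bool))
    (κY : 𝒜 × 𝒞 → PMF ((({-1, 1} : Finset ℤ) : Type) × Bool))
    (κZ : 𝒜 × ℬ → PMF Bool)
    (P : ({-1, 1} : Finset ℤ) → Bool → ({-1, 1} : Finset ℤ) → Bool → Bool → ℝ≥0∞)
    (hP : ∀ tx tb ty ta z, P tx tb ty ta z
      = ∑ a : 𝒜, ∑ b : ℬ, ∑ c : 𝒞,
          pA a * pB b * pC c * κX (b, c) (tx, tb) * κY (a, c) (ty, ta) * κZ (a, b) z)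
    (hand : ∀ tx tb ty ta z, z ≠ (ta && tb) → P tx tb ty ta z = 0)
    (hZpos : 0 < ∑ tx : ({-1, 1} : Finset ℤ), ∑ tb : Bool,
        ∑ ty : ({-1, 1} : Finset ℤ), ∑ ta : Bool, P tx tb ty ta true)
    (hABpos : ∀ ta tb : Bool,
      0 < ∑ tx : ({-1, 1} : Finset ℤ), ∑ ty : ({-1, 1} : Finset ℤ), ∑ z : Bool,
            P tx tb ty ta z)
    (E : Bool → Bool → ℝ)
    (hE : ∀ ta tb, E ta tb
      = (∑ tx : ({-1, 1} : Finset ℤ), ∑ ty : ({-1, 1} : Finset ℤ),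
            ((tx : ℤ) : ℝ) * ((ty : ℤ) : ℝ) * (∑ z : Bool, P tx tb ty ta z).toReal)
          / (∑ tx : ({-1, 1} : Finset ℤ), ∑ ty : ({-1, 1} : Finset ℤ), ∑ z : Bool,
                P tx tb ty ta z).toReal) :
    E false false + E false true + E true false - E true true ≤ 2 := by
  obtain ⟨a₀, b₀, ha₀, hb₀, hz₀⟩ :
      ∃ a₀ b₀, pA a₀ ≠ 0 ∧ pB b₀ ≠ 0 ∧ κZ (a₀, b₀) true ≠ 0 := by
    by_contra! hcon
    refine hZpos.ne' (Finset.sum_eq_zero fun x _ => Finset.sum_eq_zero fun tb _ =>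
      Finset.sum_eq_zero fun y _ => Finset.sum_eq_zero fun ta _ => ?_)
    rw [hP]
    refine Finset.sum_eq_zero fun a _ => Finset.sum_eq_zero fun b _ =>
      Finset.sum_eq_zero fun c _ => ?_
    by_cases ha : pA a = 0
    · simp [ha]
    by_cases hb : pB b = 0
    · simp [hb]
    rw [hcon a b ha hb, mul_zero]
  have hsupp : ∀ a b c x tb y ta z, pA a ≠ 0 → pB b ≠ 0 → pC c ≠ 0 → κX (b, c) (x, tb) ≠ 0 →
      κY (a, c) (y, ta) ≠ 0 → κZ (a, b) z ≠ 0 → z = (ta && tb) := by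
    intro a b c x tb y ta z ha hb hc hx hy hz
    by_contra hne
    have h := hand x tb y ta z hne
    rw [hP] at h
    simp only [Finset.sum_eq_zero_iff, Finset.mem_univ, true_imp_iff] at h
    exact mul_ne_zero (mul_ne_zero (mul_ne_zero (mul_ne_zero (mul_ne_zero ha hb) hc) hx) hy) hz
      (h a b c)
  obtain ⟨⟨β, hβ⟩, α, hα⟩ := exists_bit_functions hsupp ha₀ hb₀ hz₀
  set f : ({-1, 1} : Finset ℤ) → ℝ := fun s => ((s : ℤ) : ℝ) with hf_def
  have hf : ∀ s, |f s| ≤ 1 := by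
    rintro ⟨s, hs⟩
    rcases Finset.mem_insert.mp hs with rfl | hs
    · simp [hf_def]
    · rw [Finset.mem_singleton] at hs
      simp [hf_def, hs]
  set r : Bool → ℝ := fun t => ∑ b, (pB b).toReal * if t = β b then 1 else 0
  set q : Bool → ℝ := fun t => ∑ a, (pA a).toReal * if t = α a then 1 else 0
  have hr : ∀ c, pC c ≠ 0 → ∀ t, outcomeMean pB κX (fun _ => 1) t c = r t :=
    fun c hc => outcomeMean_one_eq (hβ c hc)
  have hq : ∀ c, pC c ≠ 0 → ∀ t, outcomeMean pA κY (fun _ => 1) t c = q t :=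
    fun c hc => outcomeMean_one_eq (hα c hc)
  have hpC : ∀ c, (pC c).toReal ≠ 0 → pC c ≠ 0 := fun c hc h => hc (by simp [h])
  have hmass : ∀ x tb y ta, (∑ z, P x tb y ta z).toReal
      = ∑ a, ∑ b, ∑ c, (pA a).toReal * (pB b).toReal * (pC c).toReal
        * (κX (b, c) (x, tb)).toReal * (κY (a, c) (y, ta)).toReal := fun x tb y ta => by
    simp only [hP]
    exact toReal_sum_triangle pA pB pC κX κY κZ x y tb ta
  have hfin : ∀ x tb y ta, ∑ z, P x tb y ta z ≠ ⊤ := fun x tb y ta => by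
    simp [hP, ENNReal.sum_eq_top, ENNReal.mul_eq_top, PMF.apply_ne_top]
  have hden : ∀ ta tb, (∑ x, ∑ y, ∑ z, P x tb y ta z).toReal = q ta * r tb := by
    intro ta tb
    rw [ENNReal.toReal_sum fun x _ => ENNReal.sum_ne_top.2 fun y _ => hfin x tb y ta]
    simp only [ENNReal.toReal_sum fun y _ => hfin _ tb y ta, hmass]
    have h := sum_bell_eq pA pB pC κX κY (fun _ => 1) (fun _ => 1) tb ta
    simp only [one_mul] at h
    rw [h]
    calc _ = ∑ c, (pC c).toReal * (q ta * r tb) := Finset.sum_congr rfl fun c _ => by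
            by_cases hc : pC c = 0
            · simp [hc]
            · rw [hr c hc, hq c hc]
      _ = q ta * r tb := by rw [← Finset.sum_mul, pC.sum_toReal_eq_one, one_mul]
  have hpos : ∀ ta tb, 0 < q ta * r tb := fun ta tb => by
    rw [← hden]
    exact ENNReal.toReal_pos (hABpos ta tb).ne' (ENNReal.sum_ne_top.2 fun x _ =>
      ENNReal.sum_ne_top.2 fun y _ => hfin x tb y ta)
  have hr0 : ∀ t, 0 ≤ r t := fun t => Finset.sum_nonneg fun b _ => by positivity
  have hq0 : ∀ t, 0 ≤ q t := fun t => Finset.sum_nonneg fun a _ => by positivity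
  have hrpos : ∀ t, 0 < r t := fun t => pos_of_mul_pos_right (hpos t t) (hq0 t)
  have hqpos : ∀ t, 0 < q t := fun t => pos_of_mul_pos_left (hpos t t) (hr0 t)
  have hE' : ∀ ta tb, E ta tb = ∑ c, (pC c).toReal
      * (outcomeMean pA κY f ta c / q ta * (outcomeMean pB κX f tb c / r tb)) := by
    intro ta tb
    rw [hE, hden]
    simp only [hmass]
    rw [sum_bell_eq pA pB pC κX κY f f tb ta, Finset.sum_div]
    refine Finset.sum_congr rfl fun c _ => ?_
    rw [div_mul_div_comm, mul_div_assoc]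
  simp only [hE']
  refine chsh_local_model (fun c => ENNReal.toReal_nonneg) pC.sum_toReal_eq_one
    (u := fun t c => outcomeMean pA κY f t c / q t)
    (v := fun t c => outcomeMean pB κX f t c / r t) (fun t c hc => ?_) (fun t c hc => ?_)
  · rw [abs_div, abs_of_pos (hqpos t), div_le_one (hqpos t), ← hq c (hpC c hc)]
    exact abs_outcomeMean_le pA κY hf t c
  · rw [abs_div, abs_of_pos (hrpos t), div_le_one (hrpos t), ← hr c (hpC c hc)]
    exact abs_outcomeMean_le pB κX hf t c
end
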